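/- arXiv:1911.07548 — 2 statements merged into one kernel-verified Lean document; each statement's English description precedes it below -/
import Mathlib

section
/- Let Ῡ₁ and Ῡ₂ be p×p diagonal matrices with diagonal entries μ_{1,i} and μ_{2,i} satisfying 0 < μ_{1,i} < μ_{2,i} ≤ 1 for every i, and suppose F x ≠ 0. Then Ῡ₁ Ω_h + Ω_d + Ψ and Ῡ₂ Ω_h + Ω_d + Ψ are invertible and x^T F^T (Ῡ₂ Ω_h + Ω_d + Ψ)^{-1} Ῡ₂ F x > x^T F^T (Ῡ₁ Ω_h + Ω_d + Ψ)^{-1} Ῡ₁ F x; that is, for any constant c the UDP-like optimal cost c − x^T F^T (Ῡ Ω_h + Ω_d + Ψ)^{-1} Ῡ F x is strictly decreasing in the packet-transmission probabilities. -/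
open Matrix

theorem aux_inv_lt {p : ℕ} (A B : Matrix (Fin p) (Fin p) ℝ) (hA : A.PosDef) (hB : B.PosDef)
    (hAB : (A - B).PosDef) (y : Fin p → ℝ) (hy : y ≠ 0) :
    y ⬝ᵥ (A⁻¹ *ᵥ y) < y ⬝ᵥ (B⁻¹ *ᵥ y) := by
  have hAu : IsUnit A.det := hA.det_pos.ne'.isUnit
  have hBu : IsUnit B.det := hB.det_pos.ne'.isUnit
  obtain ⟨u, hu⟩ : ∃ u, u = A⁻¹ *ᵥ y := ⟨_, rfl⟩
  obtain ⟨v, hv⟩ : ∃ v, v = B⁻¹ *ᵥ y := ⟨_, rfl⟩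
  have h1 : A *ᵥ u = y := by
    rw [hu, mulVec_mulVec, mul_nonsing_inv _ hAu, one_mulVec]
  have h2 : B *ᵥ v = y := by
    rw [hv, mulVec_mulVec, mul_nonsing_inv _ hBu, one_mulVec]
  have hu0 : u ≠ 0 := by
    rintro rfl
    exact hy (by rw [← h1, mulVec_zero])
  rw [← hu, ← hv]
  have h3 := hB.posSemidef.dotProduct_mulVec_nonneg (v - u)
  have h4 := hAB.dotProduct_mulVec_pos hu0
  have hsym : v ⬝ᵥ (B *ᵥ u) = u ⬝ᵥ y := by
    have hT : Bᵀ = B := by simpa using hB.isHermitian.eq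
    rw [dotProduct_mulVec, ← mulVec_transpose, hT, h2, dotProduct_comm]
  simp only [star_trivial, mulVec_sub, sub_mulVec, sub_dotProduct, dotProduct_sub, h1, h2,
    hsym] at h3 h4
  rw [dotProduct_comm y u, dotProduct_comm y v]
  linarith

theorem aux_fact {p : ℕ} (Ωg : Matrix (Fin p) (Fin p) ℝ) (ψ μ : Fin p → ℝ) (hμ : ∀ i, 0 < μ i) :
    diagonal μ * (Ωg - diagonal (fun i => Ωg i i)) + diagonal (fun i => Ωg i i) + diagonal ψ
      = diagonal μ * (Ωg + diagonal (fun i => (Ωg i i + ψ i) / μ i - Ωg i i)) := by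
  ext i j
  have := (hμ i).ne'
  by_cases h : i = j
  · subst h
    simp
    field_simp
  · simp [h]

theorem aux_pos {p : ℕ} (Ωg : Matrix (Fin p) (Fin p) ℝ) (hΩg : Ωg.PosSemidef)
    (ψ μ : Fin p → ℝ) (hψ : ∀ i, 0 < ψ i) (hμ : ∀ i, 0 < μ i) (hμ1 : ∀ i, μ i ≤ 1) :
    (Ωg + diagonal (fun i => (Ωg i i + ψ i) / μ i - Ωg i i)).PosDef := by
  refine PosDef.posSemidef_add hΩg (PosDef.diagonal fun i => ?_)
  have h0 : 0 ≤ Ωg i i := hΩg.diag_nonneg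
  rw [sub_pos, lt_div_iff₀ (hμ i)]
  nlinarith [hψ i, hμ1 i]

theorem aux_inv {p : ℕ} (M : Matrix (Fin p) (Fin p) ℝ) (hM : M.PosDef) (μ : Fin p → ℝ)
    (hμ : ∀ i, 0 < μ i) :
    IsUnit (diagonal μ * M).det ∧ (diagonal μ * M)⁻¹ * diagonal μ = M⁻¹ := by
  have hd : IsUnit (diagonal μ).det := (PosDef.diagonal hμ).det_pos.ne'.isUnit
  refine ⟨?_, ?_⟩
  · rw [det_mul]
    exact hd.mul hM.det_pos.ne'.isUnit
  · rw [Matrix.mul_inv_rev, Matrix.mul_assoc, nonsing_inv_mul _ hd, Matrix.mul_one]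

/-- the UDP-like optimal cost `c − xᵀFᵀ(Ῡ Ωh + Ωd + Ψ)⁻¹ Ῡ F x` is strictly
decreasing in the packet-transmission probabilities: if `0 < μ₁ i < μ₂ i ≤ 1` for every `i`
and `F x ≠ 0`, then both `Ῡ₁ Ωh + Ωd + Ψ` and `Ῡ₂ Ωh + Ωd + Ψ` are invertible and the
quadratic form at `Ῡ₂` strictly exceeds the one at `Ῡ₁`. -/
theorem udp_cost_strictly_decreasing
    (p n : ℕ) (hp : 0 < p) (hn : 0 < n)
    (Ωg : Matrix (Fin p) (Fin p) ℝ) (hΩg : Ωg.PosSemidef)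
    (ψ : Fin p → ℝ) (hψ : ∀ i, 0 < ψ i)
    (μ₁ μ₂ : Fin p → ℝ) (hμ : ∀ i, 0 < μ₁ i ∧ μ₁ i < μ₂ i ∧ μ₂ i ≤ 1)
    (F : Matrix (Fin p) (Fin n) ℝ) (x : Fin n → ℝ)
    (hFx : F *ᵥ x ≠ 0) :
    let Ψ : Matrix (Fin p) (Fin p) ℝ := Matrix.diagonal ψ
    let Ωd : Matrix (Fin p) (Fin p) ℝ := Matrix.diagonal (fun i => Ωg i i)
    let Ωh : Matrix (Fin p) (Fin p) ℝ := Ωg - Ωd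
    let Υ₁ : Matrix (Fin p) (Fin p) ℝ := Matrix.diagonal μ₁
    let Υ₂ : Matrix (Fin p) (Fin p) ℝ := Matrix.diagonal μ₂
    IsUnit (Υ₁ * Ωh + Ωd + Ψ).det ∧ IsUnit (Υ₂ * Ωh + Ωd + Ψ).det ∧
      (F *ᵥ x) ⬝ᵥ (((Υ₂ * Ωh + Ωd + Ψ)⁻¹ * Υ₂) *ᵥ (F *ᵥ x)) >
        (F *ᵥ x) ⬝ᵥ (((Υ₁ * Ωh + Ωd + Ψ)⁻¹ * Υ₁) *ᵥ (F *ᵥ x)) ∧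
      ∀ c : ℝ,
        c - (F *ᵥ x) ⬝ᵥ (((Υ₂ * Ωh + Ωd + Ψ)⁻¹ * Υ₂) *ᵥ (F *ᵥ x)) <
          c - (F *ᵥ x) ⬝ᵥ (((Υ₁ * Ωh + Ωd + Ψ)⁻¹ * Υ₁) *ᵥ (F *ᵥ x)) := by
  intro Ψ Ωd Ωh Υ₁ Υ₂
  have hm1 : ∀ i, 0 < μ₁ i := fun i => (hμ i).1
  have hm2 : ∀ i, 0 < μ₂ i := fun i => (hμ i).1.trans (hμ i).2.1
  have e1 := aux_fact Ωg ψ μ₁ hm1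
  have e2 := aux_fact Ωg ψ μ₂ hm2
  have p1 := aux_pos Ωg hΩg ψ μ₁ hψ hm1 fun i => (hμ i).2.1.le.trans (hμ i).2.2
  have p2 := aux_pos Ωg hΩg ψ μ₂ hψ hm2 fun i => (hμ i).2.2
  obtain ⟨u1, i1⟩ := aux_inv _ p1 μ₁ hm1
  obtain ⟨u2, i2⟩ := aux_inv _ p2 μ₂ hm2
  rw [← e1] at u1 i1
  rw [← e2] at u2 i2
  have key : (F *ᵥ x) ⬝ᵥ (((Υ₁ * Ωh + Ωd + Ψ)⁻¹ * Υ₁) *ᵥ (F *ᵥ x)) <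
      (F *ᵥ x) ⬝ᵥ (((Υ₂ * Ωh + Ωd + Ψ)⁻¹ * Υ₂) *ᵥ (F *ᵥ x)) := by
    simp only [Υ₁, Υ₂, Ωh, Ωd, Ψ]
    rw [i1, i2]
    refine aux_inv_lt _ _ p1 p2 ?_ _ hFx
    rw [add_sub_add_left_eq_sub, diagonal_sub]
    refine PosDef.diagonal fun i => ?_
    have h0 : 0 ≤ Ωg i i := hΩg.diag_nonneg
    have := div_lt_div_of_pos_left (add_pos_of_nonneg_of_pos h0 (hψ i)) (hm1 i) (hμ i).2.1
    linarith
  exact ⟨u1, u2, key, fun c => sub_lt_sub_left key c⟩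
end

section
/- Assume every diagonal entry of Ω_g is strictly positive and F x ≠ 0. For ν ∈ [0,1] the matrices G_F(ν) = ν Ω_g + Ψ and G_G(ν) = ν Ω_h + Ω_d + Ψ are invertible, and the cost difference J_Δ(ν) = ν · x^T F^T ( G_F(ν)^{-1} − G_G(ν)^{-1} ) F x satisfies: J_Δ(ν) = 0 if and only if ν = 0 or ν = 1, and J_Δ(ν) > 0 for all ν ∈ (0,1). -/
open Matrix

theorem aux_pos_s7 {p : ℕ} (A D : Matrix (Fin p) (Fin p) ℝ) (hA : A.PosDef) (hD : D.PosDef)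
    (y : Fin p → ℝ) (hy : y ≠ 0) : 0 < y ⬝ᵥ ((A⁻¹ - (A + D)⁻¹) *ᵥ y) := by
  have hB : (A + D).PosDef := hA.add hD
  have uA : IsUnit A.det := (Matrix.isUnit_iff_isUnit_det A).1 hA.isUnit
  have uB : IsUnit (A + D).det := (Matrix.isUnit_iff_isUnit_det _).1 hB.isUnit
  rw [Matrix.sub_mulVec]
  obtain ⟨v, hv⟩ : ∃ v, v = A⁻¹ *ᵥ y := ⟨_, rfl⟩
  obtain ⟨u, hu⟩ : ∃ u, u = (A + D)⁻¹ *ᵥ y := ⟨_, rfl⟩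
  have h1 : A *ᵥ v = y := by
    rw [hv, Matrix.mulVec_mulVec, Matrix.mul_nonsing_inv _ uA, Matrix.one_mulVec]
  have h2 : A *ᵥ u + D *ᵥ u = y := by
    rw [← Matrix.add_mulVec, hu, Matrix.mulVec_mulVec, Matrix.mul_nonsing_inv _ uB,
      Matrix.one_mulVec]
  rw [← hv, ← hu]
  have hu0 : u ≠ 0 := by
    rintro rfl
    apply hy
    rw [← h2]; simp
  have h3 : A *ᵥ (v - u) = D *ᵥ u := by
    rw [Matrix.mulVec_sub, h1, ← h2]; simp
  have hAt : Aᵀ = A := by simpa using hA.isHermitian.eq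
  have h4 : y ⬝ᵥ (v - u) = v ⬝ᵥ (A *ᵥ (v - u)) := by
    rw [Matrix.dotProduct_mulVec, ← Matrix.mulVec_transpose, hAt, h1]
  have h5 : 0 ≤ (v - u) ⬝ᵥ (A *ᵥ (v - u)) := by
    simpa using hA.posSemidef.dotProduct_mulVec_nonneg (v - u)
  have h6 : 0 < u ⬝ᵥ (D *ᵥ u) := by
    simpa using hD.dotProduct_mulVec_pos hu0
  rw [h4]
  rw [sub_dotProduct, h3] at h5
  rw [h3]
  linarith

/-- scalar channel: for `ν ∈ [0,1]` the matrices `G_F(ν) = ν Ωg + Ψ` and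
`G_G(ν) = ν Ωh + Ωd + Ψ` are invertible, and the cost difference
`J_Δ(ν) = ν · xᵀFᵀ(G_F(ν)⁻¹ − G_G(ν)⁻¹) F x` vanishes exactly at `ν = 0` and `ν = 1`,
being strictly positive on `(0,1)`. -/
theorem cost_difference_zero_iff_endpoints
    (p n : ℕ) (hp : 0 < p) (hn : 0 < n)
    (Ωg : Matrix (Fin p) (Fin p) ℝ) (hΩg : Ωg.PosSemidef)
    (hΩgd : ∀ i, 0 < Ωg i i)
    (ψ : Fin p → ℝ) (hψ : ∀ i, 0 < ψ i)
    (F : Matrix (Fin p) (Fin n) ℝ) (x : Fin n → ℝ)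
    (hFx : F *ᵥ x ≠ 0) :
    let Ψ : Matrix (Fin p) (Fin p) ℝ := Matrix.diagonal ψ
    let Ωd : Matrix (Fin p) (Fin p) ℝ := Matrix.diagonal (fun i => Ωg i i)
    let Ωh : Matrix (Fin p) (Fin p) ℝ := Ωg - Ωd
    let GF : ℝ → Matrix (Fin p) (Fin p) ℝ := fun ν => ν • Ωg + Ψ
    let GG : ℝ → Matrix (Fin p) (Fin p) ℝ := fun ν => ν • Ωh + Ωd + Ψ
    let JΔ : ℝ → ℝ := fun ν =>
      ν * ((F *ᵥ x) ⬝ᵥ (((GF ν)⁻¹ - (GG ν)⁻¹) *ᵥ (F *ᵥ x)))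
    (∀ ν ∈ Set.Icc (0 : ℝ) 1, IsUnit (GF ν).det ∧ IsUnit (GG ν).det) ∧
    (∀ ν ∈ Set.Icc (0 : ℝ) 1, (JΔ ν = 0 ↔ ν = 0 ∨ ν = 1)) ∧
    (∀ ν ∈ Set.Ioo (0 : ℝ) 1, 0 < JΔ ν) := by
  intro Ψ Ωd Ωh GF GG JΔ
  have hΨ : Ψ.PosDef := Matrix.PosDef.diagonal hψ
  have hΩd : Ωd.PosDef := Matrix.PosDef.diagonal hΩgd
  have hGF : ∀ ν, 0 ≤ ν → (GF ν).PosDef := fun ν h =>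
    Matrix.PosDef.posSemidef_add (hΩg.smul h) hΨ
  have hGG : ∀ ν, GG ν = GF ν + (1 - ν) • Ωd := by
    intro ν
    simp only [GG, GF, Ωh, smul_sub, sub_smul, one_smul]
    abel
  have hGG' : ∀ ν, 0 ≤ ν → ν ≤ 1 → (GG ν).PosDef := fun ν h h' => by
    rw [hGG]
    exact (hGF ν h).add_posSemidef (hΩd.posSemidef.smul (sub_nonneg.2 h'))
  have hpos : ∀ ν ∈ Set.Ioo (0 : ℝ) 1, 0 < JΔ ν := by
    rintro ν ⟨h0, h1⟩
    refine mul_pos h0 ?_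
    rw [hGG]
    exact aux_pos_s7 _ _ (hGF ν h0.le) (hΩd.smul (sub_pos.2 h1)) _ hFx
  refine ⟨fun ν h => ⟨(Matrix.isUnit_iff_isUnit_det _).1 (hGF ν h.1).isUnit,
    (Matrix.isUnit_iff_isUnit_det _).1 (hGG' ν h.1 h.2).isUnit⟩, fun ν h => ⟨fun hJ => ?_, ?_⟩, hpos⟩
  · by_contra hc
    push Not at hc
    exact (hpos ν ⟨lt_of_le_of_ne h.1 (Ne.symm hc.1), lt_of_le_of_ne h.2 hc.2⟩).ne' hJ
  · rintro (rfl | rfl)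
    · simp [JΔ]
    · have : GG 1 = GF 1 := by rw [hGG]; simp
      simp [JΔ, this]
end
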